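/- Fix l ≥ 1, let Σ_S be given by an asynchronous state space system B_S of trajectories ℕ → Γ × X with external behavior B, and let Σ_S^{l↑} be the canonical state space system for B^{l↑}. Then the relation R₀ is a 0-initial simulation relation from Σ_S to Σ_S^{l↑}. -/

import Mathlib

namespace LComplete

/-- The string `(γ s, γ (s+1), …, γ (s+len-1))`, i.e. the restriction `γ|[s, s+len-1]`. -/
def window {Γ : Type*} (γ : ℕ → Γ) (s len : ℕ) : List Γ :=
  (List.range len).map fun i => γ (s + i)

/-- The set of restrictions `B|[s, s+len-1]` of all signals in the behavior `B`. -/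
def windowSet {Γ : Type*} (B : Set (ℕ → Γ)) (s len : ℕ) : Set (List Γ) :=
  (fun γ => window γ s len) '' B

/-- `(Γ, B)` is asynchronously `m`-complete: a signal belongs to `B` iff its initial
string of length `m` is an initial string of `B` and every sliding window of length
`m+1` occurs somewhere in `B`. -/
def AsyncComplete {Γ : Type*} (m : ℕ) (B : Set (ℕ → Γ)) : Prop :=
  ∀ γ : ℕ → Γ,
    γ ∈ B ↔ (window γ 0 m ∈ windowSet B 0 m ∧
      ∀ k : ℕ, ∃ k' : ℕ, window γ k (m + 1) ∈ windowSet B k' (m + 1))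

/-- The behavior `B^{m↑}` of the strongest asynchronous `m`-complete approximation. -/
def lift {Γ : Type*} (m : ℕ) (B : Set (ℕ → Γ)) : Set (ℕ → Γ) :=
  { γ | window γ 0 m ∈ windowSet B 0 m ∧
      ∀ k : ℕ, ∃ k' : ℕ, window γ k (m + 1) ∈ windowSet B k' (m + 1) }

/-- The concatenation `w₁ ∧_{t₁}^{t₂} w₂`. -/
def concat {V : Type*} (w₁ w₂ : ℕ → V) (t₁ t₂ : ℕ) : ℕ → V :=
  fun t => if t < t₁ then w₁ t else w₂ (t - t₁ + t₂)

/-- `BS` is an asynchronous state space system. -/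
def IsAsyncSS {W X : Type*} (BS : Set ((ℕ → W) × (ℕ → X))) : Prop :=
  ∀ p ∈ BS, ∀ q ∈ BS, ∀ t₁ t₂ : ℕ, p.2 t₁ = q.2 t₂ →
    (concat p.1 q.1 t₁ t₂, concat p.2 q.2 t₁ t₂) ∈ BS

/-- State set `Z'` of the canonical state space system for `B'`. -/
def canonState {Γ : Type*} (l : ℕ) (B' : Set (ℕ → Γ)) : Set (List Γ) :=
  { ζ | (ζ.length < l ∧ ζ ∈ windowSet B' 0 ζ.length) ∨
        (ζ.length = l ∧ ∃ k : ℕ, ζ ∈ windowSet B' k l) }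

/-- Behavior `B'_S` of the canonical state space system for `B'`. -/
def canonBeh {Γ : Type*} (l : ℕ) (B' : Set (ℕ → Γ)) :
    Set ((ℕ → Γ) × (ℕ → List Γ)) :=
  { p | p.1 ∈ B' ∧
      ∀ k : ℕ, p.2 k = if k < l then window p.1 0 k else window p.1 (k - l) l }

/-- The external behavior of a state space behavior. -/
def extBeh {Γ X : Type*} (BS : Set ((ℕ → Γ) × (ℕ → X))) : Set (ℕ → Γ) :=
  { γ | ∃ x : ℕ → X, (γ, x) ∈ BS }

/-- `R` is an `m`-initial simulation relation from the system with behavior `BS₁`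
to the system with behavior `BS₂`. -/
def InitSim {Γ X₁ X₂ : Type*} (m : ℕ) (BS₁ : Set ((ℕ → Γ) × (ℕ → X₁)))
    (BS₂ : Set ((ℕ → Γ) × (ℕ → X₂))) (R : Set (X₁ × X₂)) : Prop :=
  (∀ p ∈ BS₁, ∃ q ∈ BS₂, (p.2 m, q.2 m) ∈ R) ∧
  (∀ p ∈ BS₁, ∀ q' ∈ BS₂, ∀ t₁ t₂ : ℕ, (p.2 t₁, q'.2 t₂) ∈ R →
    ∃ q ∈ BS₂,
      q.1 = concat q'.1 p.1 t₂ t₁ ∧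
      (∀ t ≤ t₂, q.2 t = q'.2 t) ∧
      ∀ j : ℕ, 1 ≤ j → (p.2 (t₁ + j), q.2 (t₂ + j)) ∈ R)

/-- `R` is a synchronous simulation relation from the system with behavior `BS₁`
to the system with behavior `BS₂`. -/
def SyncSim {Γ X₁ X₂ : Type*} (BS₁ : Set ((ℕ → Γ) × (ℕ → X₁)))
    (BS₂ : Set ((ℕ → Γ) × (ℕ → X₂))) (R : Set (X₁ × X₂)) : Prop :=
  (∀ t : ℕ, ∀ p ∈ BS₁, ∃ q ∈ BS₂, (p.2 t, q.2 t) ∈ R) ∧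
  (∀ p ∈ BS₁, ∀ q' ∈ BS₂, ∀ t : ℕ, (p.2 t, q'.2 t) ∈ R →
    ∃ q ∈ BS₂,
      q.1 = concat q'.1 p.1 t t ∧
      (∀ s ≤ t, q.2 s = q'.2 s) ∧
      ∀ j : ℕ, 1 ≤ j → (p.2 (t + j), q.2 (t + j)) ∈ R)

/-- `X^{k,ζ}`: states reached at time `k` with recent past `ζ`. -/
def reachAt {Γ X : Type*} (BS : Set ((ℕ → Γ) × (ℕ → X))) (k : ℕ) (ζ : List Γ) :
    Set X :=
  { ξ | ∃ p ∈ BS, p.2 k = ξ ∧ window p.1 (k - ζ.length) ζ.length = ζ }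

/-- `X_ζ`: states compatible with recent past `ζ`. -/
def reach {Γ X : Type*} (BS : Set ((ℕ → Γ) × (ℕ → X))) (ζ : List Γ) : Set X :=
  { ξ | ∃ k : ℕ, ζ.length ≤ k ∧ ξ ∈ reachAt BS k ζ }

/-- The relation `R₀ ⊆ X × Z'`. -/
def R0 {Γ X : Type*} (l : ℕ) (BS : Set ((ℕ → Γ) × (ℕ → X))) (B : Set (ℕ → Γ)) :
    Set (X × List Γ) :=
  { p | p.2 ∈ canonState l (lift l B) ∧
      ((p.2.length < l ∧ p.1 ∈ reachAt BS p.2.length p.2) ∨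
       (p.2.length = l ∧ p.1 ∈ reach BS p.2)) }

/-- The relation `R_l ⊆ X × Z'`. -/
def Rl {Γ X : Type*} (l : ℕ) (BS : Set ((ℕ → Γ) × (ℕ → X))) (B : Set (ℕ → Γ)) :
    Set (X × List Γ) :=
  { p | p.2 ∈ canonState l (lift l B) ∧ p.2.length = l ∧ p.1 ∈ reach BS p.2 }

/-- The relation `R_X ⊆ X × X`. -/
def RX {Γ X : Type*} (l : ℕ) (BS : Set ((ℕ → Γ) × (ℕ → X))) : Set (X × X) :=
  { p | ∃ ζ : List Γ, ζ.length = l ∧ p.1 ∈ reach BS ζ ∧ p.2 ∈ reach BS ζ }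

/-- The inverse of a relation. -/
def inv {X₁ X₂ : Type*} (R : Set (X₁ × X₂)) : Set (X₂ × X₁) :=
  { p | (p.2, p.1) ∈ R }

/-- The full behavior `B_f(P)` of a state machine `P = (X, W, δ, X₀)`. -/
def fullBeh {W X : Type*} (δ : Set (X × W × X)) (X₀ : Set X) :
    Set ((ℕ → W) × (ℕ → X)) :=
  { p | p.2 0 ∈ X₀ ∧ ∀ t : ℕ, (p.2 t, p.1 t, p.2 (t + 1)) ∈ δ }

/-- The transition relation `δ` of the canonical realization of `B'`. -/
def canonDelta {Γ : Type*} (l : ℕ) (B' : Set (ℕ → Γ)) :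
    Set (List Γ × Γ × List Γ) :=
  { t | (t.1.length < l ∧ t.2.2 = t.1 ++ [t.2.1] ∧
          t.1 ++ [t.2.1] ∈ windowSet B' 0 (t.1.length + 1)) ∨
        (t.1.length = l ∧ t.2.2 = t.1.tail ++ [t.2.1] ∧
          ∃ k' : ℕ, t.1 ++ [t.2.1] ∈ windowSet B' k' (l + 1)) }

end LComplete

namespace LComplete

theorem window_eq_window_iff {Γ : Type*} {γ γ' : ℕ → Γ} {s s' len : ℕ} :
    window γ s len = window γ' s' len ↔ ∀ i < len, γ (s + i) = γ' (s' + i) := by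
  simp [window]

@[simp]
theorem length_window {Γ : Type*} (γ : ℕ → Γ) (s len : ℕ) :
    (window γ s len).length = len := by
  simp [window]

/-- The state of the canonical state space system at time `k` along the signal `γ`. -/
def past {Γ : Type*} (l : ℕ) (γ : ℕ → Γ) (k : ℕ) : List Γ :=
  if k < l then window γ 0 k else window γ (k - l) l

theorem past_congr {Γ : Type*} {l k : ℕ} {γ γ' : ℕ → Γ} (h : ∀ i < k, γ i = γ' i) :
    past l γ k = past l γ' k := by
  unfold past
  split_ifs <;> exact window_eq_window_iff.2 fun i hi => h _ (by omega)

theorem past_mem_canonState {Γ : Type*} {l : ℕ} {B' : Set (ℕ → Γ)} {γ : ℕ → Γ}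
    (hγ : γ ∈ B') (k : ℕ) : past l γ k ∈ canonState l B' := by
  unfold past
  split_ifs with h
  · exact Or.inl ⟨by simpa using h, γ, hγ, by simp⟩
  · exact Or.inr ⟨by simp, k - l, γ, hγ, rfl⟩

theorem mem_lift_of_mem {Γ : Type*} {B : Set (ℕ → Γ)} {γ : ℕ → Γ} (m : ℕ) (hγ : γ ∈ B) :
    γ ∈ lift m B :=
  ⟨⟨γ, hγ, rfl⟩, fun k => ⟨k, γ, hγ, rfl⟩⟩

theorem fst_mem_extBeh {Γ X : Type*} {BS : Set ((ℕ → Γ) × (ℕ → X))}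
    {p : (ℕ → Γ) × (ℕ → X)} (hp : p ∈ BS) : p.1 ∈ extBeh BS :=
  ⟨p.2, hp⟩

theorem mem_R0_past {Γ X : Type*} {l : ℕ} {BS : Set ((ℕ → Γ) × (ℕ → X))}
    {p : (ℕ → Γ) × (ℕ → X)} (hp : p ∈ BS) (k : ℕ) :
    (p.2 k, past l p.1 k) ∈ R0 l BS (extBeh BS) := by
  refine ⟨past_mem_canonState (mem_lift_of_mem l (fst_mem_extBeh hp)) k, ?_⟩
  unfold past
  split_ifs with h
  · exact Or.inl ⟨by simpa using h, p, hp, by simp, by simp⟩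
  · exact Or.inr ⟨by simp, k, by simpa using h, p, hp, rfl, by simp⟩

/-- Following a signal `γ` of the approximation up to time `t` and then a signal of `B`,
whose past at time `k` agrees with that of `γ` on the last `l` steps, stays in the
approximation. -/
theorem mem_lift_of_agree {Γ : Type*} {l t k : ℕ} {B : Set (ℕ → Γ)} {γ γ' η : ℕ → Γ}
    (hγ : γ ∈ lift l B) (hη : η ∈ B) (ht : l ≤ t)
    (hlt : ∀ i < t, γ' i = γ i) (hge : ∀ i, γ' (t - l + i) = η (k - l + i)) :
    γ' ∈ lift l B := by
  refine ⟨?_, fun s => ?_⟩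
  · rw [show window γ' 0 l = window γ 0 l from
      window_eq_window_iff.2 fun i hi => hlt _ (by omega)]
    exact hγ.1
  · by_cases hs : s + l + 1 ≤ t
    · rw [show window γ' s (l + 1) = window γ s (l + 1) from
        window_eq_window_iff.2 fun i hi => hlt _ (by omega)]
      exact hγ.2 s
    · refine ⟨k - l + (s - (t - l)), η, hη, window_eq_window_iff.2 fun i _ => ?_⟩
      rw [show s + i = t - l + (s - (t - l) + i) by omega, hge, add_assoc]

theorem concat_apply_of_lt {V : Type*} {w₁ w₂ : ℕ → V} {t₁ t₂ t : ℕ} (h : t < t₁) :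
    concat w₁ w₂ t₁ t₂ t = w₁ t := if_pos h

theorem concat_apply_add {V : Type*} (w₁ w₂ : ℕ → V) (t₁ t₂ j : ℕ) :
    concat w₁ w₂ t₁ t₂ (t₁ + j) = w₂ (t₂ + j) := by
  simp [concat, add_comm]

end LComplete

open LComplete

/-- `R₀` is a `0`-initial simulation relation from the original system
`Σ_S` to the canonical state space system of its strongest asynchronous `l`-complete
approximation `Σ_S^{l↑}`. -/
theorem R0_initSim {Γ X : Type*} [Nonempty Γ] (l : ℕ) (hl : 1 ≤ l)
    (BS : Set ((ℕ → Γ) × (ℕ → X))) (hBS : LComplete.IsAsyncSS BS)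
    (B : Set (ℕ → Γ)) (hB : B = LComplete.extBeh BS) :
    LComplete.InitSim 0 BS (LComplete.canonBeh l (LComplete.lift l B))
      (LComplete.R0 l BS B) := by
  subst hB
  refine ⟨fun p hp => ⟨(p.1, past l p.1),
    ⟨mem_lift_of_mem l (fst_mem_extBeh hp), fun _ => rfl⟩, mem_R0_past hp 0⟩, ?_⟩
  rintro p hp ⟨γ', z⟩ ⟨hγ', hz⟩ t₁ t₂ ⟨-, hR⟩
  obtain rfl : z = past l γ' := funext hz
  have hpast : ∀ t ≤ t₂, past l (concat γ' p.1 t₂ t₁) t = past l γ' t := fun t ht =>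
    past_congr fun i hi => concat_apply_of_lt (by omega)
  dsimp only at hR hγ' ⊢
  by_cases h : t₂ < l
  · have hw : past l γ' t₂ = window γ' 0 t₂ := if_pos h
    simp only [hw, length_window] at hR
    obtain ⟨-, q, hq, hqx, hqw⟩ := hR.resolve_right fun h' => h.ne h'.1
    simp only [length_window, Nat.sub_self, window_eq_window_iff, zero_add] at hqw
    have hm := hBS q hq p hp t₂ t₁ hqx
    have hc : concat q.1 p.1 t₂ t₁ = concat γ' p.1 t₂ t₁ := by
      funext t
      unfold concat
      split_ifs with ht
      · exact hqw t ht
      · rfl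
    rw [hc] at hm
    refine ⟨(concat γ' p.1 t₂ t₁, past l (concat γ' p.1 t₂ t₁)),
      ⟨mem_lift_of_mem l (fst_mem_extBeh hm), fun _ => rfl⟩, rfl, hpast,
      fun j _ => ?_⟩
    have := mem_R0_past (l := l) hm (t₂ + j)
    dsimp only at this
    rwa [concat_apply_add q.2 p.2] at this
  · have hw : past l γ' t₂ = window γ' (t₂ - l) l := if_neg h
    simp only [hw, length_window, lt_irrefl, false_and, true_and, false_or] at hR
    obtain ⟨k, hk, q, hq, hqx, hqw⟩ := hR
    simp only [length_window] at hk hqw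
    rw [window_eq_window_iff] at hqw
    have hm := hBS q hq p hp k t₁ hqx
    have hge : ∀ i, concat γ' p.1 t₂ t₁ (t₂ - l + i) =
        concat q.1 p.1 k t₁ (k - l + i) := by
      intro i
      by_cases hi : i < l
      · rw [concat_apply_of_lt (by omega), concat_apply_of_lt (by omega), hqw i hi]
      · rw [show t₂ - l + i = t₂ + (i - l) by omega,
          show k - l + i = k + (i - l) by omega, concat_apply_add, concat_apply_add]
    have hlift := mem_lift_of_agree hγ' (fst_mem_extBeh hm)
      (not_lt.1 h) (fun i hi => concat_apply_of_lt hi) hge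
    refine ⟨(concat γ' p.1 t₂ t₁, past l (concat γ' p.1 t₂ t₁)),
      ⟨hlift, fun _ => rfl⟩, rfl, hpast, fun j _ => ?_⟩
    have := mem_R0_past (l := l) hm (k + j)
    dsimp only at this
    have he : past l (concat γ' p.1 t₂ t₁) (t₂ + j) =
        past l (concat q.1 p.1 k t₁) (k + j) := by
      rw [past, past, if_neg (by omega), if_neg (by omega), window_eq_window_iff]
      intro i _
      rw [show t₂ + j - l + i = t₂ - l + (j + i) by omega, hge]
      congr 1
      omega
    rwa [concat_apply_add q.2 p.2, ← he] at this
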